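/- With α_n = n(n−1)^{2n}/Γ(n)^{1/(n−1)} and γ_n = (n−1)κ_{n−1}²/(κ_{n−2}κ_n), one has lim_{n→∞} (α_n/(n^n γ_n^n)) (1−1/n)^{−n/2} = 1, and consequently lim_{n→∞} (n^n γ_n^n/α_n) (1−1/n)^{n/2} = 1. -/

import Mathlib

open MeasureTheory

noncomputable section

/-- Euclidean `n`-space. -/
abbrev E (n : ℕ) := EuclideanSpace ℝ (Fin n)

/-- `κ_n`, the volume of the Euclidean unit ball of `ℝ^n`. -/
def kappa (n : ℕ) : ℝ := (volume (Metric.ball (0 : E n) 1)).toReal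

/-- `γ_n = (n-1) κ_{n-1}² / (κ_{n-2} κ_n)`. -/
def gammaC (n : ℕ) : ℝ := ((n : ℝ) - 1) * kappa (n-1) ^ 2 / (kappa (n-2) * kappa n)

/-- `α_n = n (n-1)^{2n} / Γ(n)^{1/(n-1)}`. -/
def alphaC (n : ℕ) : ℝ := n * ((n : ℝ) - 1) ^ (2*n) / (Real.Gamma n) ^ (((n:ℝ) - 1)⁻¹)

open Filter Topology Real

/-- The ratio `Γ(n/2) Γ(n/2+1) / Γ((n+1)/2)²`, which equals `κ_{n-1}² / (κ_{n-2} κ_n)`. -/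
def halfGammaRatio (n : ℕ) : ℝ :=
  Real.Gamma ((n : ℝ) / 2) * Real.Gamma ((n : ℝ) / 2 + 1) / Real.Gamma (((n : ℝ) + 1) / 2) ^ 2

lemma nonneg_of_add_two_le_of_tendsto_zero {f : ℕ → ℝ} (hf : ∀ n, f (n + 2) ≤ f n)
    (h : Tendsto f atTop (𝓝 0)) (n : ℕ) : 0 ≤ f n := by
  have hanti : Antitone (fun k : ℕ => f (n + 2 * k)) := antitone_nat_of_succ_le fun k => hf _
  have hlim : Tendsto (fun k : ℕ => f (n + 2 * k)) atTop (𝓝 0) :=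
    h.comp (tendsto_atTop_mono (fun k => by simp only [id]; omega) tendsto_id)
  simpa using hanti.le_of_tendsto hlim 0

lemma tendsto_mul_log_succ_sub_log :
    Tendsto (fun n : ℕ => ((n : ℝ) + 1) * (log (n + 2) - log (n + 1))) atTop (𝓝 1) := by
  have h := (tendsto_mul_log_one_add_div_atTop 1).comp
    (tendsto_atTop_add_const_right atTop (1 : ℝ) tendsto_natCast_atTop_atTop)
  refine h.congr fun n => ?_
  have hn : (0 : ℝ) < n + 1 := by positivity
  simp only [Function.comp_apply]
  rw [← log_div (by positivity) hn.ne']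
  congr 2
  field_simp
  ring

lemma tendsto_log_succ_sub_log :
    Tendsto (fun n : ℕ => log ((n : ℝ) + 2) - log (n + 1)) atTop (𝓝 0) := by
  have h := tendsto_mul_log_succ_sub_log.mul (tendsto_one_div_add_atTop_nhds_zero_nat (𝕜 := ℝ))
  rw [mul_zero] at h
  refine h.congr fun n => ?_
  have hn : (0 : ℝ) < n + 1 := by positivity
  field_simp

lemma log_sub_log_convex (n : ℕ) :
    2 * (log ((n : ℝ) + 3) - log (n + 2)) ≤
      (log ((n : ℝ) + 2) - log (n + 1)) + (log ((n : ℝ) + 4) - log (n + 3)) := by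
  have h : log (((n : ℝ) + 1) * (n + 3) ^ 3) ≤ log (((n : ℝ) + 2) ^ 3 * (n + 4)) := by
    refine log_le_log (by positivity) ?_
    have hn : (0 : ℝ) ≤ n := by positivity
    nlinarith
  rw [log_mul (by positivity) (by positivity), log_mul (by positivity) (by positivity),
    log_pow, log_pow] at h
  push_cast at h
  linarith

lemma tendsto_mul_of_add_succ_eq_log {a : ℕ → ℝ} (h0 : ∀ n, 0 ≤ a n)
    (hs : ∀ n : ℕ, a n + a (n + 1) = log ((n : ℝ) + 2) - log (n + 1)) :
    Tendsto (fun n : ℕ => ((n : ℝ) + 1) * a n) atTop (𝓝 (1 / 2)) := by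
  have ha : Tendsto a atTop (𝓝 0) :=
    squeeze_zero h0 (fun n => by linarith [hs n, h0 (n + 1)]) tendsto_log_succ_sub_log
  have hs1 (n : ℕ) : a (n + 1) + a (n + 2) = log ((n : ℝ) + 3) - log (n + 2) := by
    have := hs (n + 1)
    push_cast at this
    rw [this]
    ring_nf
  have hs2 (n : ℕ) : a (n + 2) + a (n + 3) = log ((n : ℝ) + 4) - log (n + 3) := by
    have := hs (n + 2)
    push_cast at this
    rw [this]
    ring_nf
  have hanti (n : ℕ) : 0 ≤ a n - a (n + 1) := by
    refine nonneg_of_add_two_le_of_tendsto_zero (f := fun n => a n - a (n + 1)) (fun n => ?_) ?_ n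
    · change a (n + 2) - a (n + 3) ≤ a n - a (n + 1)
      linarith [hs n, hs1 n, hs2 n, log_sub_log_convex n]
    · simpa using ha.sub (ha.comp (tendsto_add_atTop_nat 1))
  have hupper : Tendsto (fun n : ℕ => 1 / 2 * (((n : ℝ) + 1) * (log (n + 2) - log (n + 1)) +
      (log (n + 2) - log (n + 1)))) atTop (𝓝 (1 / 2)) := by
    simpa using (tendsto_mul_log_succ_sub_log.add tendsto_log_succ_sub_log).const_mul (1 / 2 : ℝ)
  have hlower := ((tendsto_add_atTop_iff_nat 1).2 tendsto_mul_log_succ_sub_log).const_mul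
    (1 / 2 : ℝ)
  rw [mul_one] at hlower
  refine (tendsto_add_atTop_iff_nat 1).1 ?_
  refine tendsto_of_tendsto_of_tendsto_of_le_of_le hlower hupper (fun n => ?_) (fun n => ?_)
  · have h1 := hs (n + 1)
    have h2 := hanti (n + 1)
    have hn : (0 : ℝ) ≤ ((n + 1 : ℕ) : ℝ) + 1 := by positivity
    simp only
    nlinarith
  · have h1 := hs n
    have h2 := hanti n
    have hn : (0 : ℝ) ≤ (n : ℝ) + 2 := by positivity
    push_cast
    nlinarith

lemma halfGammaRatio_pos {n : ℕ} (hn : 0 < n) : 0 < halfGammaRatio n := by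
  have h : (0 : ℝ) < n := by exact_mod_cast hn
  have h1 := Real.Gamma_pos_of_pos (show (0 : ℝ) < n / 2 by positivity)
  have h2 := Real.Gamma_pos_of_pos (show (0 : ℝ) < (n : ℝ) / 2 + 1 by positivity)
  have h3 := Real.Gamma_pos_of_pos (show (0 : ℝ) < ((n : ℝ) + 1) / 2 by positivity)
  unfold halfGammaRatio
  positivity

lemma one_le_halfGammaRatio {n : ℕ} (hn : 0 < n) : 1 ≤ halfGammaRatio n := by
  have h : (0 : ℝ) < n := by exact_mod_cast hn
  have h1 := Real.Gamma_pos_of_pos (show (0 : ℝ) < n / 2 by positivity)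
  have h2 := Real.Gamma_pos_of_pos (show (0 : ℝ) < (n : ℝ) / 2 + 1 by positivity)
  have h3 := Real.Gamma_pos_of_pos (show (0 : ℝ) < ((n : ℝ) + 1) / 2 by positivity)
  have key := Real.Gamma_mul_add_mul_le_rpow_Gamma_mul_rpow_Gamma
    (show (0 : ℝ) < n / 2 by positivity) (show (0 : ℝ) < (n : ℝ) / 2 + 1 by positivity)
    (show (0 : ℝ) < 1 / 2 by norm_num) (show (0 : ℝ) < 1 / 2 by norm_num) (by norm_num)
  rw [show 1 / 2 * ((n : ℝ) / 2) + 1 / 2 * ((n : ℝ) / 2 + 1) = ((n : ℝ) + 1) / 2 by ring,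
    ← mul_rpow h1.le h2.le, ← sqrt_eq_rpow] at key
  unfold halfGammaRatio
  rw [one_le_div (by positivity)]
  exact (le_sqrt h3.le (by positivity)).1 key

lemma halfGammaRatio_mul_succ {n : ℕ} (hn : 0 < n) :
    halfGammaRatio n * halfGammaRatio (n + 1) = ((n : ℝ) + 1) / n := by
  have h : (0 : ℝ) < n := by exact_mod_cast hn
  have h1 := Real.Gamma_pos_of_pos (show (0 : ℝ) < n / 2 by positivity)
  have h3 := Real.Gamma_pos_of_pos (show (0 : ℝ) < ((n : ℝ) + 1) / 2 by positivity)
  unfold halfGammaRatio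
  push_cast
  rw [show ((n : ℝ) + 1 + 1) / 2 = n / 2 + 1 by ring,
    Real.Gamma_add_one (show (n : ℝ) / 2 ≠ 0 by positivity),
    Real.Gamma_add_one (show ((n : ℝ) + 1) / 2 ≠ 0 by positivity)]
  field_simp

lemma tendsto_halfGammaRatio_pow :
    Tendsto (fun n : ℕ => halfGammaRatio n ^ n) atTop (𝓝 (exp (1 / 2))) := by
  have h := tendsto_mul_of_add_succ_eq_log (a := fun n => log (halfGammaRatio (n + 1)))
    (fun n => log_nonneg (one_le_halfGammaRatio n.succ_pos)) (fun n => by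
      rw [← log_mul (halfGammaRatio_pos n.succ_pos).ne' (halfGammaRatio_pos (by omega)).ne',
        halfGammaRatio_mul_succ n.succ_pos, log_div (by positivity) (by positivity)]
      push_cast
      ring_nf)
  refine (tendsto_add_atTop_iff_nat 1).1 (((continuous_exp.tendsto _).comp h).congr fun n => ?_)
  have := halfGammaRatio_pos n.succ_pos
  simp only [Function.comp_apply]
  rw [← Real.exp_log (pow_pos this _), log_pow]
  push_cast
  rfl

lemma gammaC_eq {n : ℕ} (hn : 3 ≤ n) : gammaC n = ((n : ℝ) - 1) * halfGammaRatio n := by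
  obtain ⟨k, rfl⟩ := Nat.exists_eq_add_of_le' hn
  have hk (m : ℕ) : kappa (m + 1) = √π ^ (m + 1) / Real.Gamma (((m : ℝ) + 1) / 2 + 1) := by
    have : 0 < Real.Gamma (((m : ℝ) + 1) / 2 + 1) := Real.Gamma_pos_of_pos (by positivity)
    unfold kappa
    rw [EuclideanSpace.volume_ball]
    simp only [ENNReal.ofReal_one, one_pow, one_mul, Fintype.card_fin]
    push_cast
    exact ENNReal.toReal_ofReal (by positivity)
  have h1 := Real.Gamma_pos_of_pos (show (0 : ℝ) < ((k : ℝ) + 3) / 2 by positivity)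
  have h2 := Real.Gamma_pos_of_pos (show (0 : ℝ) < ((k : ℝ) + 3) / 2 + 1 by positivity)
  have h3 := Real.Gamma_pos_of_pos (show (0 : ℝ) < ((k : ℝ) + 3 + 1) / 2 by positivity)
  have hpi : 0 < √π := by positivity
  unfold gammaC halfGammaRatio
  rw [show k + 3 - 1 = k + 1 + 1 by omega, show k + 3 - 2 = k + 1 by omega,
    show k + 3 = k + 2 + 1 by omega, hk, hk, hk]
  push_cast
  rw [show ((k : ℝ) + 1 + 1) / 2 + 1 = ((k : ℝ) + 3 + 1) / 2 by ring,
    show ((k : ℝ) + 1) / 2 + 1 = ((k : ℝ) + 3) / 2 by ring,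
    show (k : ℝ) + 2 + 1 = k + 3 by ring]
  field_simp
  ring

lemma tendsto_log_factorial_div_sub_log :
    Tendsto (fun n : ℕ => log (n.factorial : ℝ) / n - log n) atTop (𝓝 (-1)) := by
  have h1 : Tendsto (fun n : ℕ => log (Stirling.stirlingSeq n) / n) atTop (𝓝 0) :=
    ((continuousAt_log (by positivity)).tendsto.comp
      Stirling.tendsto_stirlingSeq_sqrt_pi).div_atTop tendsto_natCast_atTop_atTop
  have h2 : Tendsto (fun n : ℕ => log (2 * (n : ℝ)) / (2 * n)) atTop (𝓝 0) := by
    have := (tendsto_pow_log_div_mul_add_atTop 1 0 1 one_ne_zero).comp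
      (tendsto_natCast_atTop_atTop.const_mul_atTop (two_pos (α := ℝ)))
    simpa [Function.comp_def] using this
  have h := (h1.add h2).sub_const 1
  rw [add_zero, zero_sub] at h
  refine h.congr' ?_
  filter_upwards [eventually_gt_atTop 0] with n hn
  have hn : (0 : ℝ) < n := by exact_mod_cast hn
  rw [Stirling.log_stirlingSeq_formula, log_div hn.ne' (exp_ne_zero _), log_exp]
  field_simp
  ring

lemma tendsto_div_Gamma_rpow :
    Tendsto (fun n : ℕ => (n : ℝ) / Real.Gamma n ^ (((n : ℝ) - 1)⁻¹)) atTop (𝓝 (exp 1)) := by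
  refine (tendsto_add_atTop_iff_nat 2).1 ?_
  have h := tendsto_log_succ_sub_log.sub
    ((tendsto_add_atTop_iff_nat 1).2 tendsto_log_factorial_div_sub_log)
  rw [zero_sub, neg_neg] at h
  refine ((continuous_exp.tendsto _).comp h).congr fun n => ?_
  have hf : (0 : ℝ) < (n + 1).factorial := by positivity
  simp only [Function.comp_apply]
  push_cast
  rw [show (n : ℝ) + 2 = ((n + 1 : ℕ) : ℝ) + 1 by push_cast; ring, Real.Gamma_nat_eq_factorial,
    rpow_def_of_pos hf, add_sub_cancel_right, ← Real.exp_log (show (0 : ℝ) < ((n + 1 : ℕ) : ℝ) + 1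
      by positivity), ← exp_sub, log_exp]
  push_cast
  congr 1
  ring

lemma tendsto_one_sub_one_div_pow :
    Tendsto (fun n : ℕ => (1 - 1 / (n : ℝ)) ^ n) atTop (𝓝 (exp (-1))) :=
  (tendsto_one_add_div_pow_exp (-1)).congr fun n => by ring

lemma one_sub_one_div_nonneg {n : ℕ} (hn : 1 ≤ n) : 0 ≤ 1 - 1 / (n : ℝ) := by
  have : (1 : ℝ) ≤ n := by exact_mod_cast hn
  rw [sub_nonneg, div_le_one (by positivity)]
  exact this

lemma tendsto_one_sub_one_div_rpow_neg_half :
    Tendsto (fun n : ℕ => (1 - 1 / (n : ℝ)) ^ (-(n : ℝ) / 2)) atTop (𝓝 (exp (1 / 2))) := by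
  have h := tendsto_one_sub_one_div_pow.rpow_const (p := -1 / 2) (Or.inl (exp_ne_zero _))
  rw [← exp_mul] at h
  norm_num at h
  norm_num
  refine h.congr' ?_
  filter_upwards [eventually_ge_atTop 1] with n hn
  have h0 := one_sub_one_div_nonneg hn
  rw [one_div] at h0
  rw [← rpow_natCast, ← rpow_mul h0]
  ring_nf

lemma tendsto_alphaC_div :
    Tendsto (fun n : ℕ => alphaC n / ((n : ℝ) ^ n * gammaC n ^ n) *
      (1 - 1 / (n : ℝ)) ^ (-(n : ℝ) / 2)) atTop (𝓝 1) := by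
  have h := ((tendsto_div_Gamma_rpow.mul tendsto_one_sub_one_div_pow).div
    tendsto_halfGammaRatio_pow (exp_ne_zero _)).mul tendsto_one_sub_one_div_rpow_neg_half
  rw [← exp_add, div_mul_cancel₀ _ (exp_ne_zero _), add_neg_cancel, exp_zero] at h
  refine h.congr' ?_
  filter_upwards [eventually_ge_atTop 3] with n hn
  congr 1
  have h3 : (3 : ℝ) ≤ n := by exact_mod_cast hn
  have hr := halfGammaRatio_pos (show 0 < n by omega)
  have hG : 0 < Real.Gamma n ^ (((n : ℝ) - 1)⁻¹) :=
    rpow_pos_of_pos (Real.Gamma_pos_of_pos (by linarith)) _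
  have hn0 : (n : ℝ) ≠ 0 := by positivity
  have hn1 : (n : ℝ) - 1 ≠ 0 := by linarith
  simp only [Pi.div_apply]
  rw [gammaC_eq hn, alphaC, one_sub_div hn0, div_pow, mul_pow, two_mul, pow_add]
  field_simp

/-- `lim (α_n/(n^n γ_n^n)) (1-1/n)^{-n/2} = 1` and consequently
`lim (n^n γ_n^n/α_n) (1-1/n)^{n/2} = 1`. -/
theorem alpha_gamma_asymptotics :
    Filter.Tendsto
      (fun n : ℕ =>
        alphaC n / ((n : ℝ) ^ n * gammaC n ^ n) * (1 - 1 / (n : ℝ)) ^ (-(n : ℝ)/2))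
      Filter.atTop (nhds 1) ∧
    Filter.Tendsto
      (fun n : ℕ =>
        (n : ℝ) ^ n * gammaC n ^ n / alphaC n * (1 - 1 / (n : ℝ)) ^ ((n : ℝ)/2))
      Filter.atTop (nhds 1) := by
  refine ⟨tendsto_alphaC_div, ?_⟩
  have h := tendsto_alphaC_div.inv₀ one_ne_zero
  rw [inv_one] at h
  refine h.congr' ?_
  filter_upwards [eventually_ge_atTop 1] with n hn
  rw [mul_inv, inv_div, ← rpow_neg (one_sub_one_div_nonneg hn), neg_div, neg_neg]
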